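/- Let α ∈ (1,2] and let γ be a probability measure on [1,∞) that is a fixed point of the α-recursive distributional equation. For r ≥ 1 define κ(r) = Σ_{k=2}^∞ k·θ_α(k) · ∫_{[1,∞)^k} (r·t₁/(r + t₁ + ⋯ + t_k − 1)) γ^{⊗k}(dt₁⋯dt_k). Then κ(r) is finite for every r ≥ 1, and for every r ≥ 1 one has the invariance identity κ(r) = Σ_{k=2}^∞ k·θ_α(k) · ∫₀¹ dx ∫_{[1,∞)^{k−1}} (r/(r + t₂ + ⋯ + t_k)) · κ((x + (1−x)/(r + t₂ + ⋯ + t_k))^{−1}) γ^{⊗(k−1)}(dt₂⋯dt_k). -/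

import Mathlib

open MeasureTheory

/-- The α-offspring distribution: θ_α(k) = α(2−α)(3−α)⋯(k−1−α)/k! for k ≥ 2, and 0 else. -/
noncomputable def thetaDist (α : ℝ) (k : ℕ) : ℝ :=
  if 2 ≤ k then α * (∏ i ∈ Finset.Icc 2 (k - 1), ((i : ℝ) - α)) / (Nat.factorial k : ℝ) else 0

/-- The uniform distribution on [0,1]. -/
noncomputable def unifMeasure : Measure ℝ := volume.restrict (Set.Icc 0 1)

/-- The map on measures associated with the α-recursive distributional equation. -/
noncomputable def rdeMap (α : ℝ) (γ : Measure ℝ) : Measure ℝ :=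
  Measure.sum fun k : ℕ =>
    ENNReal.ofReal (thetaDist α k) •
      Measure.map (fun p : ℝ × (Fin k → ℝ) => (p.1 + (1 - p.1) / ∑ i, p.2 i)⁻¹)
        (unifMeasure.prod (Measure.pi fun _ : Fin k => γ))

/-- γ is a probability measure on [1,∞) that is a fixed point of the α-recursive
distributional equation. -/
def IsRDEFixedPoint (α : ℝ) (γ : Measure ℝ) : Prop :=
  IsProbabilityMeasure γ ∧ γ (Set.Iio 1) = 0 ∧ rdeMap α γ = γ

/-- κ(r) = Σ_{k=2}^∞ k·θ_α(k)·∫_{[1,∞)^k} r·t₁/(r + t₁ + ⋯ + t_k − 1) γ^{⊗k}(dt);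
the summation index k ≥ 2 is encoded as k + 2 for k : ℕ. -/
noncomputable def kappaFun (α : ℝ) (γ : Measure ℝ) (r : ℝ) : ℝ :=
  ∑' k : ℕ, ((k : ℝ) + 2) * thetaDist α (k + 2) *
    ∫ t : Fin (k + 2) → ℝ, r * t 0 / (r + (∑ i, t i) - 1)
      ∂(Measure.pi fun _ : Fin (k + 2) => γ)

open scoped ENNReal

theorem thetaDist_nonneg {α : ℝ} (hα : α ≤ 2) (hα0 : 0 ≤ α) (k : ℕ) : 0 ≤ thetaDist α k := by
  unfold thetaDist
  split_ifs
  · refine div_nonneg (mul_nonneg hα0 (Finset.prod_nonneg fun i hi => ?_)) (Nat.cast_nonneg _)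
    have : (2 : ℝ) ≤ i := by exact_mod_cast (Finset.mem_Icc.mp hi).1
    linarith
  · exact le_rfl

instance : IsProbabilityMeasure unifMeasure := ⟨by simp [unifMeasure]⟩

/-- A probability measure on `[1,∞)` has all coordinates of its powers almost surely `≥ 1`. -/
theorem ae_pi_one_le {γ : Measure ℝ} [IsProbabilityMeasure γ] (h1 : γ (Set.Iio 1) = 0)
    {ι : Type*} [Fintype ι] : ∀ᵐ t ∂(Measure.pi fun _ : ι => γ), ∀ i, 1 ≤ t i := by
  have hγ : ∀ᵐ x ∂γ, 1 ≤ x := by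
    rw [ae_iff]
    simpa [Set.Iio] using h1
  exact Filter.eventually_all.2 fun i => (Measure.tendsto_eval_ae_ae (i := i)).eventually hγ

theorem one_le_sum_of_one_le {n : ℕ} {t : Fin (n + 1) → ℝ} (ht : ∀ i, 1 ≤ t i) :
    1 ≤ ∑ i, t i :=
  (ht 0).trans <| Finset.single_le_sum (fun i _ => zero_le_one.trans (ht i)) (Finset.mem_univ 0)

/-- A map from the RDE applied on one side of `φ(s,T) = sT/(s+T-1)` may be moved to the other. -/
theorem transfer_identity {x s T : ℝ} (hx : x ∈ Set.Icc (0 : ℝ) 1) (hs : 1 ≤ s) (hT : 1 ≤ T) :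
    (x + (1 - x) / s)⁻¹ * T / ((x + (1 - x) / s)⁻¹ + T - 1)
      = s * (x + (1 - x) / T)⁻¹ / (s + (x + (1 - x) / T)⁻¹ - 1) := by
  obtain ⟨h0, h1⟩ := hx
  have e1 : x + (1 - x) / s = (x * s + (1 - x)) / s := by field_simp
  have e2 : x + (1 - x) / T = (x * T + (1 - x)) / T := by field_simp
  have p1 : 0 < x * s + (1 - x) := by nlinarith
  have p2 : 0 < x * T + (1 - x) := by nlinarith
  have q : 0 < s + (T - 1) * (x * s + (1 - x)) := by nlinarith
  rw [e1, e2, inv_div, inv_div]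
  have hAB : T + (s - 1) * (x * T + (1 - x)) = s + (T - 1) * (x * s + (1 - x)) := by ring
  generalize x * s + (1 - x) = A at *
  generalize x * T + (1 - x) = B at *
  have r1 : s / A + T - 1 = (s + (T - 1) * A) / A := by field_simp; ring
  have r2 : s + T / B - 1 = (s + (T - 1) * A) / B := by rw [← hAB]; field_simp; ring
  rw [r1, r2]
  field_simp

theorem one_le_inv_interp {x s : ℝ} (hx : x ∈ Set.Icc (0 : ℝ) 1) (hs : 1 ≤ s) :
    1 ≤ (x + (1 - x) / s)⁻¹ ∧ (x + (1 - x) / s)⁻¹ ≤ s := by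
  obtain ⟨h0, h1⟩ := hx
  have e1 : x + (1 - x) / s = (x * s + (1 - x)) / s := by field_simp
  have p1 : 0 < x * s + (1 - x) := by nlinarith
  rw [e1, inv_div, le_div_iff₀ p1, div_le_iff₀ p1]
  constructor <;> nlinarith [mul_nonneg h0 (sub_nonneg.2 hs)]

/-- The value of `kappaFun` in `[0,∞]`. -/
noncomputable def kappaENN (α : ℝ) (γ : Measure ℝ) (s : ℝ) : ℝ≥0∞ :=
  ∑' k : ℕ, ENNReal.ofReal (thetaDist α (k + 2)) *
    ∫⁻ t : Fin (k + 2) → ℝ, ENNReal.ofReal (s * (∑ i, t i) / (s + (∑ i, t i) - 1))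
      ∂(Measure.pi fun _ : Fin (k + 2) => γ)

theorem measurable_kappaENN (α : ℝ) (γ : Measure ℝ) [IsProbabilityMeasure γ] :
    Measurable (kappaENN α γ) := by
  unfold kappaENN
  refine Measurable.tsum fun k => Measurable.const_mul ?_ _
  refine Measurable.lintegral_prod_right' (f := fun p : ℝ × (Fin (k + 2) → ℝ) =>
    ENNReal.ofReal (p.1 * (∑ i, p.2 i) / (p.1 + (∑ i, p.2 i) - 1))) ?_
  fun_prop

theorem tsum_eq_tsum_add_two {f : ℕ → ℝ≥0∞} (h0 : f 0 = 0) (h1 : f 1 = 0) :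
    ∑' k, f k = ∑' k, f (k + 2) := by
  rw [tsum_eq_zero_add' ENNReal.summable, tsum_eq_zero_add' ENNReal.summable, h0, h1,
    zero_add, zero_add]

theorem lintegral_rdeMap (α : ℝ) (γ : Measure ℝ) [IsProbabilityMeasure γ] {f : ℝ → ℝ≥0∞}
    (hf : Measurable f) :
    ∫⁻ y, f y ∂(rdeMap α γ) = ∑' k : ℕ, ENNReal.ofReal (thetaDist α (k + 2)) *
      ∫⁻ x, ∫⁻ t : Fin (k + 2) → ℝ, f (x + (1 - x) / ∑ i, t i)⁻¹
        ∂(Measure.pi fun _ : Fin (k + 2) => γ) ∂unifMeasure := by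
  rw [rdeMap, lintegral_sum_measure, tsum_eq_tsum_add_two]
  · refine tsum_congr fun k => ?_
    rw [lintegral_smul_measure, smul_eq_mul, lintegral_map hf (by fun_prop),
      lintegral_prod _ (by fun_prop)]
  · simp [thetaDist]
  · simp [thetaDist]

theorem tsum_thetaDist {α : ℝ} {γ : Measure ℝ} (hγ : IsRDEFixedPoint α γ) :
    ∑' k : ℕ, ENNReal.ofReal (thetaDist α (k + 2)) = 1 := by
  have : IsProbabilityMeasure γ := hγ.1
  have h := lintegral_rdeMap α γ (f := fun _ => 1) measurable_const
  rw [hγ.2.2] at h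
  simpa using h.symm

theorem kappaENN_le {α : ℝ} {γ : Measure ℝ} (hγ : IsRDEFixedPoint α γ) {s : ℝ} (hs : 1 ≤ s) :
    kappaENN α γ s ≤ ENNReal.ofReal s := by
  have : IsProbabilityMeasure γ := hγ.1
  calc kappaENN α γ s
      ≤ ∑' k : ℕ, ENNReal.ofReal (thetaDist α (k + 2)) * ENNReal.ofReal s := by
        refine ENNReal.tsum_le_tsum fun k => mul_le_mul_right ?_ _
        calc _ ≤ ∫⁻ t : Fin (k + 2) → ℝ, ENNReal.ofReal s
              ∂(Measure.pi fun _ : Fin (k + 2) => γ) := by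
              refine lintegral_mono_ae ?_
              filter_upwards [ae_pi_one_le hγ.2.1] with t ht
              refine ENNReal.ofReal_le_ofReal ?_
              have := one_le_sum_of_one_le ht
              rw [div_le_iff₀ (by linarith)]
              nlinarith
          _ = _ := by simp
    _ = ENNReal.ofReal s := by rw [ENNReal.tsum_mul_right, tsum_thetaDist hγ, one_mul]

theorem kappaENN_ne_top {α : ℝ} {γ : Measure ℝ} (hγ : IsRDEFixedPoint α γ) {s : ℝ}
    (hs : 1 ≤ s) : kappaENN α γ s ≠ ⊤ :=
  ne_top_of_le_ne_top ENNReal.ofReal_ne_top (kappaENN_le hγ hs)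

/-- Under a product of identical measures, the coordinates are exchangeable. -/
theorem lintegral_pi_coord_sum (γ : Measure ℝ) [IsProbabilityMeasure γ] {ι : Type*} [Fintype ι]
    [DecidableEq ι] (F : ℝ → ℝ → ℝ≥0∞) (i j : ι) :
    ∫⁻ t, F (t i) (∑ l, t l) ∂(Measure.pi fun _ : ι => γ)
      = ∫⁻ t, F (t j) (∑ l, t l) ∂(Measure.pi fun _ : ι => γ) := by
  have h := measurePreserving_piCongrLeft (fun _ : ι => γ) (Equiv.swap i j)
  rw [← h.lintegral_comp_emb (MeasurableEquiv.measurableEmbedding _)]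
  refine lintegral_congr fun t => ?_
  have e : ∀ l, (MeasurableEquiv.piCongrLeft (fun _ : ι => ℝ) (Equiv.swap i j)) t l
      = t (Equiv.swap i j l) := by
    intro l
    conv_lhs => rw [← Equiv.apply_symm_apply (Equiv.swap i j) l]
    rw [MeasurableEquiv.coe_piCongrLeft, Equiv.piCongrLeft_apply_apply, Equiv.symm_swap]
  simp only [e, Equiv.swap_apply_left]
  rw [Equiv.sum_comp (Equiv.swap i j) t]

theorem lintegral_sum_eq_card_mul {γ : Measure ℝ} [IsProbabilityMeasure γ]
    (h1 : γ (Set.Iio 1) = 0) {s : ℝ} (hs : 1 ≤ s) (k : ℕ) :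
    ∫⁻ t : Fin (k + 2) → ℝ, ENNReal.ofReal (s * (∑ i, t i) / (s + (∑ i, t i) - 1))
        ∂(Measure.pi fun _ : Fin (k + 2) => γ)
      = ((k : ℝ≥0∞) + 2) * ∫⁻ t : Fin (k + 2) → ℝ,
          ENNReal.ofReal (s * t 0 / (s + (∑ i, t i) - 1))
        ∂(Measure.pi fun _ : Fin (k + 2) => γ) := by
  calc _ = ∫⁻ t : Fin (k + 2) → ℝ, ∑ j, ENNReal.ofReal (s * t j / (s + (∑ i, t i) - 1))
        ∂(Measure.pi fun _ : Fin (k + 2) => γ) := by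
        refine lintegral_congr_ae ?_
        filter_upwards [ae_pi_one_le h1] with t ht
        have := one_le_sum_of_one_le ht
        rw [← ENNReal.ofReal_sum_of_nonneg, Finset.mul_sum, Finset.sum_div]
        intro j _
        have := ht j
        exact div_nonneg (by nlinarith) (by linarith)
    _ = ∑ _j : Fin (k + 2), ∫⁻ t : Fin (k + 2) → ℝ,
          ENNReal.ofReal (s * t 0 / (s + (∑ i, t i) - 1))
        ∂(Measure.pi fun _ : Fin (k + 2) => γ) := by
        rw [lintegral_finsetSum _ fun j _ => by fun_prop]
        exact Finset.sum_congr rfl fun j _ => lintegral_pi_coord_sum γ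
          (fun a b => ENNReal.ofReal (s * a / (s + b - 1))) j 0
    _ = _ := by simp

theorem kappa_term_eq_toReal {α : ℝ} (hα : α ∈ Set.Ioc (1 : ℝ) 2) {γ : Measure ℝ}
    [IsProbabilityMeasure γ] (h1 : γ (Set.Iio 1) = 0) {s : ℝ} (hs : 1 ≤ s) (k : ℕ) :
    ((k : ℝ) + 2) * thetaDist α (k + 2) *
        ∫ t : Fin (k + 2) → ℝ, s * t 0 / (s + (∑ i, t i) - 1)
          ∂(Measure.pi fun _ : Fin (k + 2) => γ)
      = (ENNReal.ofReal (thetaDist α (k + 2)) *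
        ∫⁻ t : Fin (k + 2) → ℝ, ENNReal.ofReal (s * (∑ i, t i) / (s + (∑ i, t i) - 1))
          ∂(Measure.pi fun _ : Fin (k + 2) => γ)).toReal := by
  rw [lintegral_sum_eq_card_mul h1 hs, integral_eq_lintegral_of_nonneg_ae]
  · rw [ENNReal.toReal_mul, ENNReal.toReal_mul, ENNReal.toReal_ofReal
      (thetaDist_nonneg hα.2 (by linarith [hα.1]) _), ENNReal.toReal_add (by simp) (by simp)]
    simp
    ring
  · filter_upwards [ae_pi_one_le h1] with t ht
    have := one_le_sum_of_one_le ht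
    have := ht 0
    exact div_nonneg (by nlinarith) (by linarith)
  · exact Measurable.aestronglyMeasurable (by fun_prop)

theorem kappaFun_eq_toReal {α : ℝ} (hα : α ∈ Set.Ioc (1 : ℝ) 2) {γ : Measure ℝ}
    (hγ : IsRDEFixedPoint α γ) {s : ℝ} (hs : 1 ≤ s) :
    kappaFun α γ s = (kappaENN α γ s).toReal := by
  have : IsProbabilityMeasure γ := hγ.1
  rw [kappaENN, ENNReal.tsum_toReal_eq (ENNReal.ne_top_of_tsum_ne_top (kappaENN_ne_top hγ hs))]
  exact tsum_congr fun k => kappa_term_eq_toReal hα hγ.2.1 hs k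

/-- Averaging `κ` over the uniform variable turns the sum `T` into a single `γ`-variable. -/
theorem lintegral_kappaENN {α : ℝ} {γ : Measure ℝ} (hγ : IsRDEFixedPoint α γ) {s : ℝ}
    (hs : 1 ≤ s) :
    ∫⁻ x, kappaENN α γ (x + (1 - x) / s)⁻¹ ∂unifMeasure
      = ∫⁻ y, ENNReal.ofReal (s * y / (s + y - 1)) ∂γ := by
  have : IsProbabilityMeasure γ := hγ.1
  conv_rhs => rw [← hγ.2.2, lintegral_rdeMap α γ (by fun_prop)]
  unfold kappaENN
  have hm : ∀ k, Measurable fun p : ℝ × (Fin (k + 2) → ℝ) =>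
      ENNReal.ofReal ((p.1 + (1 - p.1) / s)⁻¹ * (∑ i, p.2 i) /
        ((p.1 + (1 - p.1) / s)⁻¹ + (∑ i, p.2 i) - 1)) := fun k => by fun_prop
  rw [lintegral_tsum fun k => ((hm k).lintegral_prod_right'.const_mul _).aemeasurable]
  refine tsum_congr fun k => ?_
  rw [lintegral_const_mul _ (hm k).lintegral_prod_right']
  congr 1
  refine setLIntegral_congr_fun measurableSet_Icc fun x hx => lintegral_congr_ae ?_
  filter_upwards [ae_pi_one_le hγ.2.1] with t ht
  rw [transfer_identity hx hs (one_le_sum_of_one_le ht)]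

theorem lintegral_pi_succ (γ : Measure ℝ) [IsProbabilityMeasure γ] {n : ℕ}
    {F : ℝ → ℝ → ℝ≥0∞} (hF : Measurable (Function.uncurry F)) :
    ∫⁻ t : Fin (n + 1) → ℝ, F (t 0) (∑ i, t i) ∂(Measure.pi fun _ : Fin (n + 1) => γ)
      = ∫⁻ t : Fin n → ℝ, ∫⁻ y, F y (y + ∑ i, t i) ∂γ ∂(Measure.pi fun _ : Fin n => γ) := by
  have h := (measurePreserving_piFinSuccAbove (fun _ : Fin (n + 1) => γ) 0).symm
  rw [← h.lintegral_comp_emb (MeasurableEquiv.measurableEmbedding _)]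
  rw [lintegral_prod_symm _ (by fun_prop)]
  simp [MeasurableEquiv.piFinSuccAbove, Fin.sum_univ_succ]

theorem kappa_integral_identity {α : ℝ} (hα : α ∈ Set.Ioc (1 : ℝ) 2) {γ : Measure ℝ}
    (hγ : IsRDEFixedPoint α γ) {r : ℝ} (hr : 1 ≤ r) (k : ℕ) :
    ∫ t : Fin (k + 2) → ℝ, r * t 0 / (r + (∑ i, t i) - 1)
        ∂(Measure.pi fun _ : Fin (k + 2) => γ)
      = ∫ x in (0 : ℝ)..1, ∫ t : Fin (k + 1) → ℝ,
          (r / (r + ∑ i, t i)) * kappaFun α γ ((x + (1 - x) / (r + ∑ i, t i))⁻¹)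
          ∂(Measure.pi fun _ : Fin (k + 1) => γ) := by
  have : IsProbabilityMeasure γ := hγ.1
  have hK := measurable_kappaENN α γ
  let F : ℝ × (Fin (k + 1) → ℝ) → ℝ≥0∞ := fun p =>
    ENNReal.ofReal (r / (r + ∑ i, p.2 i)) *
      kappaENN α γ ((p.1 + (1 - p.1) / (r + ∑ i, p.2 i))⁻¹)
  have hF : Measurable F := by fun_prop
  have hFle : ∀ x ∈ Set.Icc (0 : ℝ) 1, ∀ᵐ t ∂(Measure.pi fun _ : Fin (k + 1) => γ),
      F (x, t) ≤ ENNReal.ofReal r := by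
    intro x hx
    filter_upwards [ae_pi_one_le hγ.2.1] with t ht
    have hS := one_le_sum_of_one_le ht
    have hY := one_le_inv_interp hx (by linarith : 1 ≤ r + ∑ i, t i)
    calc F (x, t) ≤ ENNReal.ofReal (r / (r + ∑ i, t i)) * ENNReal.ofReal (r + ∑ i, t i) :=
          mul_le_mul_right ((kappaENN_le hγ hY.1).trans (ENNReal.ofReal_le_ofReal hY.2)) _
      _ = ENNReal.ofReal r := by
          rw [← ENNReal.ofReal_mul (div_nonneg (by linarith) (by linarith)),
            div_mul_cancel₀ _ (by linarith)]
  have hFint : ∀ x ∈ Set.Icc (0 : ℝ) 1,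
      ∫⁻ t, F (x, t) ∂(Measure.pi fun _ : Fin (k + 1) => γ) < ⊤ := by
    intro x hx
    calc _ ≤ ∫⁻ _, ENNReal.ofReal r ∂(Measure.pi fun _ : Fin (k + 1) => γ) :=
          lintegral_mono_ae (hFle x hx)
      _ < ⊤ := by simp
  have hinner : ∀ x ∈ Set.Icc (0 : ℝ) 1, ∫ t : Fin (k + 1) → ℝ,
      (r / (r + ∑ i, t i)) * kappaFun α γ ((x + (1 - x) / (r + ∑ i, t i))⁻¹)
          ∂(Measure.pi fun _ : Fin (k + 1) => γ)
      = (∫⁻ t, F (x, t) ∂(Measure.pi fun _ : Fin (k + 1) => γ)).toReal := by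
    intro x hx
    rw [← integral_toReal (by fun_prop)
      ((hFle x hx).mono fun t ht => ht.trans_lt ENNReal.ofReal_lt_top)]
    refine integral_congr_ae ?_
    filter_upwards [ae_pi_one_le hγ.2.1] with t ht
    have hS := one_le_sum_of_one_le ht
    have hY := one_le_inv_interp hx (by linarith : 1 ≤ r + ∑ i, t i)
    rw [kappaFun_eq_toReal hα hγ hY.1, ENNReal.toReal_mul,
      ENNReal.toReal_ofReal (div_nonneg (by linarith) (by linarith))]
  rw [intervalIntegral.integral_of_le zero_le_one, ← integral_Icc_eq_integral_Ioc,
    setIntegral_congr_fun measurableSet_Icc hinner,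
    integral_toReal hF.lintegral_prod_right'.aemeasurable
      ((ae_restrict_iff' measurableSet_Icc).2 (Filter.Eventually.of_forall hFint)),
    integral_eq_lintegral_of_nonneg_ae ?_ (Measurable.aestronglyMeasurable (by fun_prop))]
  · congr 1
    rw [lintegral_pi_succ γ (F := fun a b => ENNReal.ofReal (r * a / (r + b - 1)))
      (by unfold Function.uncurry; fun_prop)]
    change _ = ∫⁻ x, ∫⁻ t, F (x, t) ∂(Measure.pi fun _ : Fin (k + 1) => γ) ∂unifMeasure
    rw [lintegral_lintegral_swap (f := fun x t => F (x, t)) hF.aemeasurable]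
    refine lintegral_congr_ae ?_
    filter_upwards [ae_pi_one_le hγ.2.1] with t ht
    have hS := one_le_sum_of_one_le ht
    simp only [F]
    rw [lintegral_const_mul _ (by fun_prop), lintegral_kappaENN hγ (by linarith),
      ← lintegral_const_mul _ (by fun_prop)]
    refine lintegral_congr fun y => ?_
    rw [← ENNReal.ofReal_mul (div_nonneg (by linarith) (by linarith))]
    congr 1
    rw [add_left_comm, add_comm y]
    field_simp
  · filter_upwards [ae_pi_one_le hγ.2.1] with t ht
    have := one_le_sum_of_one_le ht
    have := ht 0
    exact div_nonneg (by nlinarith) (by linarith)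

/-- κ(r) is finite for every r ≥ 1 and satisfies the invariance identity
κ(r) = Σ_{k=2}^∞ k·θ_α(k)·∫₀¹dx ∫ γ^{⊗(k−1)}(dt₂⋯dt_k)
        (r/(r+t₂+⋯+t_k))·κ((x + (1−x)/(r+t₂+⋯+t_k))⁻¹);
the summation index k ≥ 2 is encoded as k + 2, so that k − 1 is k + 1. -/
theorem kappa_invariance (α : ℝ) (hα : α ∈ Set.Ioc (1 : ℝ) 2)
    (γ : Measure ℝ) (hγ : IsRDEFixedPoint α γ) (r : ℝ) (hr : 1 ≤ r) :
    Summable (fun k : ℕ => ((k : ℝ) + 2) * thetaDist α (k + 2) *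
      ∫ t : Fin (k + 2) → ℝ, r * t 0 / (r + (∑ i, t i) - 1)
        ∂(Measure.pi fun _ : Fin (k + 2) => γ)) ∧
    kappaFun α γ r
      = ∑' k : ℕ, ((k : ℝ) + 2) * thetaDist α (k + 2) *
          ∫ x in (0 : ℝ)..1,
            ∫ t : Fin (k + 1) → ℝ,
              (r / (r + ∑ i, t i)) *
                kappaFun α γ ((x + (1 - x) / (r + ∑ i, t i))⁻¹)
              ∂(Measure.pi fun _ : Fin (k + 1) => γ) := by
  have : IsProbabilityMeasure γ := hγ.1
  refine ⟨?_, tsum_congr fun k => by rw [kappa_integral_identity hα hγ hr k]⟩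
  simp_rw [kappa_term_eq_toReal hα hγ.2.1 hr]
  exact ENNReal.summable_toReal (kappaENN_ne_top hγ hr)
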